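/- (Lemma 5, tail of a positive stable law via inverse Laplace transform / equation (16).) Let δ ∈ (0,1), κ > 0, and let ν be a probability measure on [0,∞) whose Laplace transform satisfies ∫_{[0,∞)} e^{−s u} dν(u) = exp(−κ s^δ) for all s > 0. Then for every x > 0, ν((x,∞)) = (1/(πδ)) ∫_0^∞ (1/w) · exp(−x·(w/κ)^{1/δ}) · exp(−w·cos(πδ)) · sin(w·sin(πδ)) dw. -/

import Mathlib

open Real MeasureTheory

namespace StableTail

lemma exp_image_univ : Real.exp '' Set.univ = Set.Ioi (0:ℝ) := by
  rw [Set.image_univ, Real.range_exp]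

lemma integrable_scaled_exp_iff {E : Type*} [NormedAddCommGroup E] [NormedSpace ℝ E]
    (k c : ℝ) (hk : 0 < k) (hc : 0 < c) (g : ℝ → E) :
    IntegrableOn g (Set.Ioi 0) ↔
      Integrable (fun s : ℝ => (k * c * Real.exp (c * s)) • g (k * Real.exp (c * s))) := by
  have him : (fun s : ℝ => k * Real.exp (c * s)) '' Set.univ = Set.Ioi (0:ℝ) := by
    ext y
    simp only [Set.image_univ, Set.mem_range, Set.mem_Ioi]
    constructor
    · rintro ⟨s, rfl⟩; positivity
    · intro hy
      refine ⟨Real.log (y / k) / c, ?_⟩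
      rw [mul_div_cancel₀ _ hc.ne', Real.exp_log (by positivity)]
      field_simp
  have := integrableOn_image_iff_integrableOn_abs_deriv_smul (s := Set.univ)
    (f := fun s : ℝ => k * Real.exp (c * s)) (f' := fun s => k * c * Real.exp (c * s))
    MeasurableSet.univ (fun x _ => by
      have := (((hasDerivAt_id x).const_mul c).exp.const_mul k).hasDerivWithinAt (s := Set.univ)
      refine this.congr_deriv ?_
      simp only [id_eq]; ring) (by
        intro a _ b _ h
        simpa [hk.ne', hc.ne'] using h) g
  rw [him, integrableOn_univ] at this
  rw [this]
  refine Iff.of_eq (congrArg (fun h => Integrable h volume) ?_)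
  funext s
  rw [abs_of_pos (by positivity)]

lemma integral_scaled_exp {E : Type*} [NormedAddCommGroup E] [NormedSpace ℝ E]
    (k c : ℝ) (hk : 0 < k) (hc : 0 < c) (g : ℝ → E) :
    ∫ r in Set.Ioi 0, g r = ∫ s : ℝ, (k * c * Real.exp (c * s)) • g (k * Real.exp (c * s)) := by
  have him : (fun s : ℝ => k * Real.exp (c * s)) '' Set.univ = Set.Ioi (0:ℝ) := by
    ext y
    simp only [Set.image_univ, Set.mem_range, Set.mem_Ioi]
    constructor
    · rintro ⟨s, rfl⟩; positivity
    · intro hy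
      refine ⟨Real.log (y / k) / c, ?_⟩
      rw [mul_div_cancel₀ _ hc.ne', Real.exp_log (by positivity)]
      field_simp
  have := integral_image_eq_integral_abs_deriv_smul (s := Set.univ)
    (f := fun s : ℝ => k * Real.exp (c * s)) (f' := fun s => k * c * Real.exp (c * s))
    MeasurableSet.univ (fun x _ => by
      have := (((hasDerivAt_id x).const_mul c).exp.const_mul k).hasDerivWithinAt (s := Set.univ)
      refine this.congr_deriv ?_
      simp only [id_eq]; ring) (by
        intro a _ b _ h
        simpa [hk.ne', hc.ne'] using h) g
  rw [him, setIntegral_univ] at this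
  rw [this]
  congr 1
  funext s
  rw [abs_of_pos (by positivity)]

lemma integrable_exp_expneg (a b c : ℝ) (ha : 0 < a) (hb : 0 < b) (hc : 0 < c) :
    Integrable (fun s : ℝ => Real.exp (b * s) * Real.exp (-(a * Real.exp (c * s)))) := by
  have h := integrableOn_rpow_mul_exp_neg_mul_rpow (p := c) (s := b - 1) (b := a)
    (by linarith) hc ha
  rw [integrable_scaled_exp_iff 1 1 one_pos one_pos] at h
  refine h.congr (Filter.Eventually.of_forall fun s => ?_)
  simp only [one_mul, smul_eq_mul]
  rw [← Real.exp_mul, ← Real.exp_mul, ← mul_assoc, ← Real.exp_add]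
  congr 2
  · ring
  · rw [mul_comm s c]; ring

lemma young (δ κ ε : ℝ) (hδ1 : δ < 1) (hδ0 : 0 < δ) (hκ : 0 < κ) (hε : 0 < ε) :
    ∃ C, ∀ s : ℝ, κ * Real.exp (δ * s) ≤ ε * Real.exp s + C := by
  refine ⟨κ * Real.exp (δ * (Real.log (κ / ε) / (1 - δ))), fun s => ?_⟩
  have h1 : 0 < 1 - δ := by linarith
  rcases le_total (Real.log (κ / ε) / (1 - δ)) s with h | h
  · rw [div_le_iff₀ h1] at h
    have : κ / ε ≤ Real.exp (s * (1 - δ)) := by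
      rw [← Real.log_le_iff_le_exp (by positivity)]; exact h
    rw [div_le_iff₀ hε] at this
    have e : Real.exp s = Real.exp (s * (1 - δ)) * Real.exp (δ * s) := by
      rw [← Real.exp_add]; congr 1; ring
    have : κ * Real.exp (δ * s) ≤ ε * Real.exp s := by
      rw [e]; nlinarith [Real.exp_pos (δ * s)]
    have : 0 < κ * Real.exp (δ * (Real.log (κ / ε) / (1 - δ))) := by positivity
    linarith
  · have : κ * Real.exp (δ * s) ≤ κ * Real.exp (δ * (Real.log (κ / ε) / (1 - δ))) := by
      gcongr
    have : 0 < ε * Real.exp s := by positivity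
    linarith

noncomputable def Psi (δ κ x : ℝ) (z : ℂ) : ℂ :=
  Complex.exp (x * Complex.exp z - κ * Complex.exp (δ * z)) * Complex.exp z / (1 - Complex.exp z)

lemma exp_sθ (s θ : ℝ) : Complex.exp ((s:ℂ) + θ * Complex.I) =
    ⟨Real.exp s * Real.cos θ, Real.exp s * Real.sin θ⟩ := by
  apply Complex.ext <;> simp [Complex.exp_re, Complex.exp_im]

lemma exp_δsθ (δ s θ : ℝ) : Complex.exp ((δ:ℂ) * ((s:ℂ) + θ * Complex.I)) =
    ⟨Real.exp (δ * s) * Real.cos (δ * θ), Real.exp (δ * s) * Real.sin (δ * θ)⟩ := by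
  apply Complex.ext <;> simp [Complex.exp_re, Complex.exp_im]

lemma cos_nonpos' {θ : ℝ} (h1 : π / 2 ≤ θ) (h2 : θ ≤ π) : Real.cos θ ≤ 0 :=
  Real.cos_nonpos_of_pi_div_two_le_of_le h1 (by linarith [Real.pi_pos])

lemma norm_Psi_le (δ κ x s θ : ℝ) (h1 : π / 2 ≤ θ) (h2 : θ ≤ π) :
    ‖Psi δ κ x ((s:ℂ) + θ * Complex.I)‖ ≤
      Real.exp s * Real.exp (x * (Real.exp s * Real.cos θ)
        - κ * (Real.exp (δ * s) * Real.cos (δ * θ))) := by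
  unfold Psi
  rw [norm_div, norm_mul, Complex.norm_exp, Complex.norm_exp]
  have hc := cos_nonpos' h1 h2
  have hn : 1 ≤ ‖1 - Complex.exp ((s:ℂ) + θ * Complex.I)‖ := by
    refine le_trans ?_ (Complex.re_le_norm _)
    rw [exp_sθ]
    simp only [Complex.sub_re, Complex.one_re]
    nlinarith [Real.exp_pos s]
  rw [exp_δsθ]
  refine (div_le_self (by positivity) hn).trans ?_
  rw [exp_sθ]
  simp [mul_comm]

lemma exists_bound (δ κ x : ℝ) (hδ0 : 0 < δ) (hδ1 : δ < 1) (hκ : 0 < κ) (hx : 0 < x) :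
    ∃ B : ℝ → ℝ, Integrable B ∧ Filter.Tendsto B Filter.atTop (nhds 0) ∧
      Filter.Tendsto B Filter.atBot (nhds 0) ∧
      ∀ s θ : ℝ, π / 2 ≤ θ → θ ≤ π → ‖Psi δ κ x ((s:ℂ) + θ * Complex.I)‖ ≤ B s := by
  have hp := Real.pi_pos
  set t := π / (1 + δ) with ht
  have htt : t * (1 + δ) = π := by rw [ht]; field_simp
  have ht1 : π / 2 < t := by nlinarith
  have ht2 : t < π := by nlinarith
  set c := - Real.cos t with hcdef
  have hc : 0 < c := by
    have := Real.cos_neg_of_pi_div_two_lt_of_lt ht1 (by linarith)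
    linarith
  have hc' : Real.cos (δ * t) = c := by
    rw [hcdef, ← Real.cos_pi_sub]; congr 1; linarith
  obtain ⟨C, hC⟩ := young δ κ (c * x / 2) hδ1 hδ0 hκ (by positivity)
  have tend0 : ∀ a d : ℝ, 0 < a → 0 < d → Filter.Tendsto
      (fun s : ℝ => Real.exp (1 * s) * Real.exp (-(a * Real.exp (d * s)))) Filter.atTop (nhds 0) := by
    intro a d ha hd
    have h := tendsto_rpow_mul_exp_neg_mul_atTop_nhds_zero (1/d) a ha
    have h2 : Filter.Tendsto (fun s : ℝ => Real.exp (d * s)) Filter.atTop Filter.atTop :=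
      Real.tendsto_exp_atTop.comp (Filter.tendsto_id.const_mul_atTop hd)
    refine (h.comp h2).congr fun s => ?_
    simp only [Function.comp_apply]
    rw [← Real.exp_mul]
    congr 2
    · field_simp
    · ring
  have tendb : ∀ a d : ℝ, 0 < a → 0 < d → Filter.Tendsto
      (fun s : ℝ => Real.exp (1 * s) * Real.exp (-(a * Real.exp (d * s)))) Filter.atBot (nhds 0) := by
    intro a d ha hd
    refine squeeze_zero (fun s => by positivity) (fun s => ?_) Real.tendsto_exp_atBot
    rw [one_mul]
    refine mul_le_of_le_one_right (by positivity) (Real.exp_le_one_iff.2 ?_)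
    have : 0 < a * Real.exp (d * s) := by positivity
    linarith
  refine ⟨fun s => Real.exp (1 * s) * Real.exp (-(κ * c * Real.exp (δ * s))) +
    Real.exp C * (Real.exp (1 * s) * Real.exp (-(c * x / 2 * Real.exp (1 * s)))), ?_, ?_, ?_, ?_⟩
  · exact (integrable_exp_expneg _ _ _ (by positivity) one_pos hδ0).add
      ((integrable_exp_expneg _ _ _ (by positivity) one_pos one_pos).const_mul _)
  · simpa using (tend0 (κ * c) δ (by positivity) hδ0).add
      ((tend0 (c * x / 2) 1 (by positivity) one_pos).const_mul (Real.exp C))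
  · simpa using (tendb (κ * c) δ (by positivity) hδ0).add
      ((tendb (c * x / 2) 1 (by positivity) one_pos).const_mul (Real.exp C))
  · intro s θ h1 h2
    refine (norm_Psi_le δ κ x s θ h1 h2).trans ?_
    have he := Real.exp_pos s
    have hd := Real.exp_pos (δ * s)
    rcases le_total θ t with h | h
    · have hcos : c ≤ Real.cos (δ * θ) := by
        rw [← hc']
        apply Real.cos_le_cos_of_nonneg_of_le_pi
        · nlinarith
        · nlinarith
        · gcongr
      have hcn := cos_nonpos' h1 h2
      have h3 : Real.exp (x * (Real.exp s * Real.cos θ)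
        - κ * (Real.exp (δ * s) * Real.cos (δ * θ))) ≤ Real.exp (-(κ * c * Real.exp (δ * s))) := by
        apply Real.exp_le_exp.2
        have a1 : x * (Real.exp s * Real.cos θ) ≤ 0 :=
          mul_nonpos_of_nonneg_of_nonpos hx.le (mul_nonpos_of_nonneg_of_nonpos he.le hcn)
        have a2 : κ * (Real.exp (δ * s) * c) ≤ κ * (Real.exp (δ * s) * Real.cos (δ * θ)) := by
          gcongr
        linarith
      have h4 : 0 ≤ Real.exp C * (Real.exp (1 * s) * Real.exp (-(c * x / 2 * Real.exp (1 * s)))) := by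
        positivity
      have := mul_le_mul_of_nonneg_left h3 he.le
      simp only [one_mul] at *
      linarith
    · have hcos : Real.cos θ ≤ - c := by
        rw [hcdef, neg_neg]
        exact Real.cos_le_cos_of_nonneg_of_le_pi (by linarith) h2 h
      have h3 : Real.exp (x * (Real.exp s * Real.cos θ)
        - κ * (Real.exp (δ * s) * Real.cos (δ * θ))) ≤
          Real.exp C * Real.exp (-(c * x / 2 * Real.exp s)) := by
        rw [← Real.exp_add]
        apply Real.exp_le_exp.2
        have a1 : x * (Real.exp s * Real.cos θ) ≤ x * (Real.exp s * (-c)) := by gcongr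
        have a2 : κ * (Real.exp (δ * s) * (-1)) ≤ κ * (Real.exp (δ * s) * Real.cos (δ * θ)) := by
          have := Real.neg_one_le_cos (δ * θ)
          gcongr
        have := hC s
        nlinarith
      have h4 : 0 ≤ Real.exp (1 * s) * Real.exp (-(κ * c * Real.exp (δ * s))) := by
        positivity
      have := mul_le_mul_of_nonneg_left h3 he.le
      simp only [one_mul] at *
      nlinarith

lemma Psi_diffAt (δ κ x : ℝ) (z : ℂ) (h1 : π / 2 ≤ z.im) (h2 : z.im ≤ π) :
    DifferentiableAt ℂ (Psi δ κ x) z := by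
  unfold Psi
  have hne : 1 - Complex.exp z ≠ 0 := by
    intro h
    have hz : (1 - Complex.exp z).re = 0 := by rw [h]; rfl
    rw [Complex.sub_re, Complex.exp_re] at hz
    have := cos_nonpos' h1 h2
    simp at hz
    nlinarith [Real.exp_pos z.re]
  fun_prop (disch := exact hne)

lemma Psi_integrable (δ κ x : ℝ) (hδ0 : 0 < δ) (hδ1 : δ < 1) (hκ : 0 < κ) (hx : 0 < x)
    (θ : ℝ) (h1 : π / 2 ≤ θ) (h2 : θ ≤ π) :
    Integrable (fun s : ℝ => Psi δ κ x ((s:ℂ) + θ * Complex.I)) := by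
  obtain ⟨B, hB, -, -, hb⟩ := exists_bound δ κ x hδ0 hδ1 hκ hx
  refine hB.mono' ?_ (Filter.Eventually.of_forall fun s => hb s θ h1 h2)
  refine Continuous.aestronglyMeasurable ?_
  rw [continuous_iff_continuousAt]
  intro s
  have := (Psi_diffAt δ κ x ((s:ℂ) + θ * Complex.I) (by simpa) (by simpa)).continuousAt
  exact ContinuousAt.comp (f := fun s : ℝ => (s:ℂ) + θ * Complex.I) this (by fun_prop)

lemma rotation (δ κ x : ℝ) (hδ0 : 0 < δ) (hδ1 : δ < 1) (hκ : 0 < κ) (hx : 0 < x) :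
    ∫ s : ℝ, Psi δ κ x ((s:ℂ) + (π / 2 : ℝ) * Complex.I) =
      ∫ s : ℝ, Psi δ κ x ((s:ℂ) + π * Complex.I) := by
  have hp := Real.pi_pos
  obtain ⟨B, hB, hBt, hBb, hb⟩ := exists_bound δ κ x hδ0 hδ1 hκ hx
  have i1 := Psi_integrable δ κ x hδ0 hδ1 hκ hx (π / 2) le_rfl (by linarith)
  have i2 := Psi_integrable δ κ x hδ0 hδ1 hκ hx π (by linarith) le_rfl
  have t1 := intervalIntegral_tendsto_integral i1
    (Filter.tendsto_neg_atTop_atBot) (Filter.tendsto_id (α := ℝ) (x := Filter.atTop))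
  have t2 := intervalIntegral_tendsto_integral i2
    (Filter.tendsto_neg_atTop_atBot) (Filter.tendsto_id (α := ℝ) (x := Filter.atTop))
  have side : ∀ u : ℝ → ℝ, Filter.Tendsto (fun R => B (u R)) Filter.atTop (nhds 0) →
      Filter.Tendsto (fun R => Complex.I • ∫ y : ℝ in (π/2)..π, Psi δ κ x ((u R : ℂ) + y * Complex.I))
        Filter.atTop (nhds 0) := by
    intro u hu
    have : Filter.Tendsto (fun R => B (u R) * |π - π / 2|) Filter.atTop (nhds 0) := by
      simpa using hu.mul_const (|π - π / 2|)
    refine squeeze_zero_norm (fun R => ?_) this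
    rw [norm_smul, Complex.norm_I, one_mul]
    refine intervalIntegral.norm_integral_le_of_norm_le_const fun y hy => ?_
    rw [Set.uIoc_of_le (by linarith)] at hy
    exact hb _ _ hy.1.le hy.2
  have s1 := side (fun R => R) hBt
  have s2 := side (fun R => -R) (hBb.comp Filter.tendsto_neg_atTop_atBot)
  have key := ((t1.sub t2).add s1).sub s2
  have zero : ∀ R : ℝ, (∫ s : ℝ in (-R)..(id R), Psi δ κ x ((s:ℂ) + (π / 2 : ℝ) * Complex.I)) -
      (∫ s : ℝ in (-R)..(id R), Psi δ κ x ((s:ℂ) + π * Complex.I)) +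
      (Complex.I • ∫ y : ℝ in (π/2)..π, Psi δ κ x (((fun R:ℝ => R) R : ℝ) + y * Complex.I)) -
      (Complex.I • ∫ y : ℝ in (π/2)..π, Psi δ κ x (((fun R:ℝ => -R) R : ℝ) + y * Complex.I)) = 0 := by
    intro R
    have := Complex.integral_boundary_rect_eq_zero_of_differentiableOn (Psi δ κ x)
      ⟨-R, π/2⟩ ⟨R, π⟩ (by
        intro z hz
        rw [Complex.mem_reProdIm] at hz
        simp only [Set.uIcc_of_le (show π/2 ≤ π by linarith)] at hz
        exact (Psi_diffAt δ κ x z hz.2.1 hz.2.2).differentiableWithinAt)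
    simpa using this
  have key2 := (tendsto_const_nhds (x := (0:ℂ)) (f := Filter.atTop (α := ℝ))).congr (fun R => (zero R).symm)
  have := tendsto_nhds_unique key key2
  simpa [sub_eq_zero] using this

end StableTail

namespace StableTail
open ProbabilityTheory

lemma ae_nonneg (ν : Measure ℝ) (hsupp : ν (Set.Iio 0) = 0) : ∀ᵐ u ∂ν, 0 ≤ u := by
  rw [ae_iff]
  simpa [Set.Iio] using hsupp

lemma laplace_complex (δ κ : ℝ)
    (ν : Measure ℝ) [IsProbabilityMeasure ν] (hsupp : ν (Set.Iio 0) = 0)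
    (hlap : ∀ s : ℝ, 0 < s →
      ∫ u, Real.exp (-(s * u)) ∂ν = Real.exp (-(κ * s ^ δ))) (s : ℝ) :
    ∫ u : ℝ, Complex.exp (-(Complex.exp ((s:ℂ) + (π/2:ℝ) * Complex.I)) * u) ∂ν
      = Complex.exp (-(κ * Complex.exp (δ * ((s:ℂ) + (π/2:ℝ) * Complex.I)))) := by
  have hp := Real.pi_pos
  have hae := ae_nonneg ν hsupp
  have hsub : Set.Iio (0:ℝ) ⊆ interior (integrableExpSet id ν) := by
    rw [← interior_Iio (a := (0:ℝ))]
    apply interior_mono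
    intro t ht
    change Integrable (fun u => Real.exp (t * id u)) ν
    refine (integrable_const (1:ℝ)).mono' (by fun_prop) ?_
    filter_upwards [hae] with u hu
    rw [Real.norm_eq_abs, abs_of_pos (Real.exp_pos _)]
    apply Real.exp_le_one_iff.2
    exact mul_nonpos_of_nonpos_of_nonneg (le_of_lt ht) hu
  set S : Set ℂ := Complex.im ⁻¹' (Set.Ioo (-(π/2)) (π/2)) with hS
  have hSo : IsOpen S := isOpen_Ioo.preimage Complex.continuous_im
  have hSc : IsPreconnected S := by
    apply Convex.isPreconnected
    exact (convex_Ioo (-(π/2)) (π/2)).linear_preimage Complex.imLm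
  have hf1 : AnalyticOnNhd ℂ (fun z => complexMGF id ν (-Complex.exp z)) S := by
    apply DifferentiableOn.analyticOnNhd _ hSo
    intro z hz
    have hm : (-Complex.exp z).re ∈ interior (integrableExpSet id ν) := by
      apply hsub
      have := Real.cos_pos_of_mem_Ioo hz
      simp only [Complex.neg_re, Complex.exp_re, Set.mem_Iio]
      have := mul_pos (Real.exp_pos z.re) this
      linarith
    have h := (hasDerivAt_complexMGF hm).differentiableAt
    exact (DifferentiableAt.comp (f := fun z => -Complex.exp z) z h (by fun_prop)).differentiableWithinAt
  have hf2 : AnalyticOnNhd ℂ (fun z => Complex.exp (-(κ * Complex.exp (δ * z)))) S := by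
    apply DifferentiableOn.analyticOnNhd _ hSo
    fun_prop
  have hreal : ∀ t : ℝ, complexMGF id ν (-Complex.exp t) = Complex.exp (-(κ * Complex.exp (δ * t))) := by
    intro t
    have := hlap (Real.exp t) (Real.exp_pos t)
    rw [← Real.exp_mul, mul_comm t δ] at this
    have e : -Complex.exp t = ((-Real.exp t : ℝ) : ℂ) := by push_cast; rfl
    rw [e, complexMGF_ofReal]
    unfold mgf
    simp only [id, neg_mul]
    rw [this]
    push_cast
    rfl
  have heq := hf1.eqOn_of_preconnected_of_frequently_eq hf2 hSc (z₀ := 0) (by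
      simp [hS, hp]) (by
      have ht : Filter.Tendsto (fun t : ℝ => (t:ℂ)) (nhdsWithin 0 {0}ᶜ) (nhdsWithin 0 {0}ᶜ) := by
        apply tendsto_nhdsWithin_of_tendsto_nhds_of_eventually_within
        · have : ContinuousAt (fun t : ℝ => (t:ℂ)) 0 := by fun_prop
          simpa using this.tendsto.mono_left nhdsWithin_le_nhds
        · filter_upwards [self_mem_nhdsWithin] with t ht
          simpa using ht
      refine ht.frequently ?_
      exact (Filter.Eventually.of_forall hreal).frequently)
  have l1 : Filter.Tendsto (fun θ : ℝ => ∫ u : ℝ, Complex.exp (-(Complex.exp ((s:ℂ) + θ * Complex.I)) * u) ∂ν)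
      (nhdsWithin (π/2) (Set.Iio (π/2)))
      (nhds (∫ u : ℝ, Complex.exp (-(Complex.exp ((s:ℂ) + (π/2:ℝ) * Complex.I)) * u) ∂ν)) := by
    apply tendsto_integral_filter_of_dominated_convergence (fun _ => (1:ℝ))
    · exact Filter.Eventually.of_forall fun θ => by fun_prop
    · have : Set.Ioo (-(π/2)) (π/2) ∈ nhdsWithin (π/2) (Set.Iio (π/2)) :=
        Ioo_mem_nhdsLT (by linarith)
      filter_upwards [this] with θ hθ
      filter_upwards [hae] with u hu
      rw [Complex.norm_exp, exp_sθ]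
      apply Real.exp_le_one_iff.2
      have := mul_nonneg (mul_nonneg (Real.exp_pos s).le (Real.cos_pos_of_mem_Ioo hθ).le) hu
      simp
      linarith
    · exact integrable_const _
    · refine Filter.Eventually.of_forall fun u => ?_
      have : ContinuousAt (fun θ : ℝ => Complex.exp (-(Complex.exp ((s:ℂ) + θ * Complex.I)) * u)) (π/2) := by
        fun_prop
      exact this.tendsto.mono_left nhdsWithin_le_nhds
  have l2 : Filter.Tendsto (fun θ : ℝ => Complex.exp (-(κ * Complex.exp (δ * ((s:ℂ) + θ * Complex.I)))))
      (nhdsWithin (π/2) (Set.Iio (π/2)))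
      (nhds (Complex.exp (-(κ * Complex.exp (δ * ((s:ℂ) + (π/2:ℝ) * Complex.I)))))) := by
    have : ContinuousAt (fun θ : ℝ => Complex.exp (-(κ * Complex.exp (δ * ((s:ℂ) + θ * Complex.I))))) (π/2) := by
      fun_prop
    exact this.tendsto.mono_left nhdsWithin_le_nhds
  refine tendsto_nhds_unique l1 (l2.congr' ?_)
  have : Set.Ioo (-(π/2)) (π/2) ∈ nhdsWithin (π/2) (Set.Iio (π/2)) :=
    Ioo_mem_nhdsLT (by linarith)
  filter_upwards [this] with θ hθ
  have := heq (x := (s:ℂ) + θ * Complex.I) (by simpa [hS] using hθ)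
  simpa [complexMGF] using this.symm

noncomputable def kern (u x : ℝ) : ℝ := if x < u then Real.exp (x - u) else 0

lemma kern_nonneg (u x : ℝ) : 0 ≤ kern u x := by
  unfold kern; split_ifs <;> positivity

lemma kern_le (u x : ℝ) : kern u x ≤ 1 := by
  unfold kern; split_ifs with h
  · exact Real.exp_le_one_iff.2 (by linarith)
  · exact zero_le_one

lemma kern_meas : Measurable (Function.uncurry kern) := by
  unfold kern Function.uncurry
  exact Measurable.ite (measurableSet_lt measurable_snd measurable_fst) (by fun_prop) (by fun_prop)

lemma kern_eq (u : ℝ) : kern u = Set.indicator (Set.Iio u) (fun x => Real.exp (-u) * Real.exp x) := by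
  funext x
  unfold kern Set.indicator
  simp only [Set.mem_Iio, ← Real.exp_add, sub_eq_neg_add]

lemma kern_integrable (u : ℝ) : Integrable (kern u) := by
  rw [kern_eq, integrable_indicator_iff measurableSet_Iio]
  exact ((integrableOn_exp_Iic u).mono_set Set.Iio_subset_Iic_self).const_mul _

lemma kern_integral (u : ℝ) : ∫ x, kern u x = 1 := by
  rw [kern_eq, integral_indicator measurableSet_Iio, integral_const_mul,
    ← integral_Iic_eq_integral_Iio, integral_exp_Iic, ← Real.exp_add]
  simp

lemma kern_fourier (u ξ : ℝ) :
    ∫ x : ℝ, Complex.exp ((-(2 * π * ξ * Complex.I)) * x) * kern u x =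
      Complex.exp ((-(2 * π * ξ * Complex.I)) * u) / (1 - 2 * π * ξ * Complex.I) := by
  have : (fun x : ℝ => Complex.exp ((-(2 * π * ξ * Complex.I)) * x) * kern u x) =
      Set.indicator (Set.Iio u) (fun x : ℝ => Complex.exp (-u) *
        Complex.exp ((1 - 2 * π * ξ * Complex.I) * x)) := by
    funext x
    rw [kern_eq]
    unfold Set.indicator
    split_ifs
    · push_cast
      rw [← Complex.exp_add, ← Complex.exp_add, ← Complex.exp_add]
      congr 1; ring
    · simp
  rw [this, integral_indicator measurableSet_Iio, integral_const_mul,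
    ← integral_Iic_eq_integral_Iio, integral_exp_mul_complex_Iic (by simp), ← mul_div_assoc,
    ← Complex.exp_add]
  congr 2; ring

lemma kern_prod_integrable (ν : Measure ℝ) [IsProbabilityMeasure ν] :
    Integrable (Function.uncurry kern) (ν.prod volume) := by
  rw [integrable_prod_iff kern_meas.aestronglyMeasurable]
  refine ⟨Filter.Eventually.of_forall kern_integrable, ?_⟩
  have : (fun u => ∫ x, ‖Function.uncurry kern (u, x)‖) = fun _ => (1:ℝ) := by
    funext u
    rw [← kern_integral u]
    congr 1; funext x
    exact Real.norm_of_nonneg (kern_nonneg u x)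
  rw [this]
  exact integrable_const _

noncomputable def ff (ν : Measure ℝ) (x : ℝ) : ℝ := ∫ u, kern u x ∂ν

lemma ff_integrable (ν : Measure ℝ) [IsProbabilityMeasure ν] : Integrable (ff ν) :=
  (kern_prod_integrable ν).integral_prod_right

lemma ff_fourier (ν : Measure ℝ) [IsProbabilityMeasure ν] (ξ : ℝ) :
    FourierTransform.fourier (fun x => (ff ν x : ℂ)) ξ =
      (∫ u : ℝ, Complex.exp ((-(2 * π * ξ * Complex.I)) * u) ∂ν) / (1 - 2 * π * ξ * Complex.I) := by
  rw [Real.fourier_real_eq_integral_exp_smul]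
  have h1 : ∀ x : ℝ, Complex.exp (((-2 * π * x * ξ : ℝ) : ℂ) * Complex.I) • (ff ν x : ℂ) =
      ∫ u : ℝ, Complex.exp ((-(2 * π * ξ * Complex.I)) * x) * kern u x ∂ν := by
    intro x
    rw [integral_const_mul, ff, integral_complex_ofReal, smul_eq_mul]
    congr 2
    push_cast; ring
  simp_rw [h1]
  rw [integral_integral_swap]
  · simp_rw [kern_fourier]
    rw [integral_div]
  · have := (kern_prod_integrable ν).swap
    have h2 : Integrable (fun p : ℝ × ℝ => ((Function.uncurry kern p.swap : ℝ):ℂ)) (volume.prod ν) :=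
      this.ofReal
    refine h2.bdd_mul (c := 1) ?_ ?_
    · exact Continuous.aestronglyMeasurable (by fun_prop)
    · refine Filter.Eventually.of_forall fun p => ?_
      rw [Complex.norm_exp]
      simp

lemma ff_continuousAt (ν : Measure ℝ) [IsProbabilityMeasure ν] (x : ℝ) (hx : ν {x} = 0) :
    ContinuousAt (ff ν) x := by
  unfold ff
  apply continuousAt_of_dominated (bound := fun _ => 1)
  · refine Filter.Eventually.of_forall fun y => ?_
    exact (kern_meas.comp (measurable_id.prodMk measurable_const)).aestronglyMeasurable
  · refine Filter.Eventually.of_forall fun y => Filter.Eventually.of_forall fun u => ?_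
    rw [Real.norm_of_nonneg (kern_nonneg u y)]
    exact kern_le u y
  · exact integrable_const _
  · have : ∀ᵐ u ∂ν, u ≠ x := by
      rw [ae_iff]; simpa using hx
    filter_upwards [this] with u hu
    unfold kern
    rcases lt_or_gt_of_ne hu with h | h
    · refine (continuousAt_const (y := (0:ℝ))).congr ?_
      filter_upwards [Ioi_mem_nhds h] with y hy
      rw [if_neg (not_lt.2 (le_of_lt hy))]
    · have : ContinuousAt (fun y => Real.exp (y - u)) x := by fun_prop
      refine this.congr ?_
      filter_upwards [Iio_mem_nhds h] with y hy
      rw [if_pos (Set.mem_Iio.1 hy)]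

lemma sym_integral (H : ℝ → ℂ) (hs : ∀ ξ, H (-ξ) = (starRingEnd ℂ) (H ξ)) (P : ℝ → ℂ)
    (hP : ∀ s : ℝ, Real.exp s • H (1 / (2 * π) * Real.exp s) = - Complex.I * P s)
    (hi : Integrable P) :
    Integrable H ∧ ∫ ξ, H ξ = (((1 / π) * (∫ s, P s).im : ℝ) : ℂ) := by
  have hp := Real.pi_pos
  have e : (fun s : ℝ => (1 / (2 * π) * 1 * Real.exp (1 * s)) • H (1 / (2 * π) * Real.exp (1 * s))) =
      fun s => ((1 / (2 * π) : ℝ) : ℂ) * (- Complex.I * P s) := by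
    funext s
    rw [← hP, one_mul, mul_one, mul_smul]
    simp
  have h1 : IntegrableOn H (Set.Ioi 0) := by
    rw [integrable_scaled_exp_iff (1 / (2 * π)) 1 (by positivity) one_pos, e]
    exact (hi.const_mul _).const_mul _
  have v1 : ∫ ξ in Set.Ioi 0, H ξ = ((1 / (2 * π) : ℝ) : ℂ) * (- Complex.I * ∫ s, P s) := by
    rw [integral_scaled_exp (1 / (2 * π)) 1 (by positivity) one_pos, e, integral_const_mul,
      integral_const_mul]
  have h1' : IntegrableOn (fun ξ => H (-ξ)) (Set.Ioi 0) := by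
    simp_rw [hs]
    have := ContinuousLinearMap.integrable_comp
      (Complex.conjCLE : ℂ →L[ℝ] ℂ) (μ := volume.restrict (Set.Ioi 0)) (φ := H) h1
    exact this
  have h2 : IntegrableOn H (Set.Iic 0) := by
    have h1n : IntegrableOn (fun ξ => H (-ξ)) (Set.Ioi (-(0:ℝ))) := by rwa [neg_zero]
    have := IntegrableOn.comp_neg_Iio h1n
    simp only [neg_neg] at this
    rwa [integrableOn_Iic_iff_integrableOn_Iio]
  have v2 : ∫ ξ in Set.Iic 0, H ξ = (starRingEnd ℂ) (∫ ξ in Set.Ioi 0, H ξ) := by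
    have := integral_comp_neg_Ioi (0:ℝ) H
    rw [neg_zero] at this
    rw [← this, ← integral_conj]
    simp_rw [hs]
  refine ⟨?_, ?_⟩
  · rw [← integrableOn_univ, ← Set.Iic_union_Ioi (a := (0:ℝ))]
    exact h2.union h1
  · rw [← intervalIntegral.integral_Iic_add_Ioi h2 h1, v2, add_comm, Complex.add_conj, v1]
    congr 1
    rw [Complex.re_ofReal_mul]
    simp
    ring

lemma ff_formula (δ κ : ℝ) (hδ0 : 0 < δ) (hδ1 : δ < 1) (hκ : 0 < κ)
    (ν : Measure ℝ) [IsProbabilityMeasure ν] (hsupp : ν (Set.Iio 0) = 0)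
    (hlap : ∀ s : ℝ, 0 < s →
      ∫ u, Real.exp (-(s * u)) ∂ν = Real.exp (-(κ * s ^ δ)))
    (x : ℝ) (hx : 0 < x) (hν : ν {x} = 0) :
    ff ν x = 1 / π * (∫ s : ℝ, Psi δ κ x ((s:ℂ) + π * Complex.I)).im := by
  have hp := Real.pi_pos
  set F : ℝ → ℂ := FourierTransform.fourier (fun x => (ff ν x : ℂ)) with hF
  have hsymF : ∀ ξ, F (-ξ) = (starRingEnd ℂ) (F ξ) := by
    intro ξ
    rw [hF, ff_fourier, ff_fourier, map_div₀, ← integral_conj]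
    congr 1
    · congr 1; funext u
      rw [← Complex.exp_conj]
      congr 1
      simp [map_ofNat (starRingEnd ℂ) 2]
    · simp [map_ofNat (starRingEnd ℂ) 2]
  have hI : Complex.exp ((π/2:ℝ) * Complex.I) = Complex.I := by
    push_cast; exact Complex.exp_pi_div_two_mul_I
  obtain ⟨hi, hv⟩ := sym_integral (fun ξ => Complex.exp ((2 * π * ξ * Complex.I) * x) * F ξ)
    (by
      intro ξ
      rw [hsymF, map_mul, ← Complex.exp_conj]
      congr 2
      simp [map_ofNat (starRingEnd ℂ) 2]) (fun s => Psi δ κ x ((s:ℂ) + (π/2:ℝ) * Complex.I)) (by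
      intro s
      have hl := laplace_complex δ κ ν hsupp hlap s
      have e1 : Complex.exp ((s:ℂ) + (π/2:ℝ) * Complex.I) = Complex.exp s * Complex.I := by
        rw [Complex.exp_add, hI]
      have e2 : (2 * π * ((1 / (2 * π) * Real.exp s : ℝ):ℂ) * Complex.I) =
          Complex.exp s * Complex.I := by
        push_cast
        have : (π:ℂ) ≠ 0 := by exact_mod_cast hp.ne'
        field_simp
      rw [hF, ff_fourier, e2, ← e1, hl]
      unfold Psi
      have e3 : Real.exp s • (1:ℂ) = - Complex.I * Complex.exp ((s:ℂ) + (π/2:ℝ) * Complex.I) := by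
        rw [e1]
        have := Complex.I_mul_I
        simp only [Complex.real_smul, Complex.ofReal_exp]
        linear_combination (Complex.exp s) * this
      have : ∀ z : ℂ, Real.exp s • z = (Real.exp s • (1:ℂ)) * z := by
        intro z; simp
      rw [this, e3, sub_eq_add_neg (_ * _ : ℂ), Complex.exp_add (_ * _ : ℂ) (-_), mul_comm (x:ℂ)]
      generalize Complex.exp ((s:ℂ) + (π/2:ℝ) * Complex.I) = E1
      generalize Complex.exp (-(κ * Complex.exp (δ * ((s:ℂ) + (π/2:ℝ) * Complex.I)))) = E2
      ring) (Psi_integrable δ κ x hδ0 hδ1 hκ hx _ le_rfl (by linarith))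
  rw [rotation δ κ x hδ0 hδ1 hκ hx] at hv
  have hFi : Integrable F := by
    have : Integrable (fun ξ : ℝ => Complex.exp (-(2 * π * ξ * Complex.I) * x) *
        (Complex.exp ((2 * π * ξ * Complex.I) * x) * F ξ)) := by
      refine hi.bdd_mul (c := 1) (Continuous.aestronglyMeasurable (by fun_prop)) ?_
      refine Filter.Eventually.of_forall fun p => ?_
      rw [Complex.norm_exp]
      simp
    refine this.congr (Filter.Eventually.of_forall fun ξ => ?_)
    simp only []
    rw [← mul_assoc, ← Complex.exp_add]
    simp
  have hc : ContinuousAt (fun x => (ff ν x : ℂ)) x :=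
    Complex.continuous_ofReal.continuousAt.comp (ff_continuousAt ν x hν)
  have hinv := ((ff_integrable ν).ofReal (𝕜 := ℂ)).fourierInv_fourier_eq hFi hc
  rw [Real.fourierInv_eq'] at hinv
  have : (ff ν x : ℂ) = ((1 / π * (∫ s : ℝ, Psi δ κ x ((s:ℂ) + π * Complex.I)).im : ℝ) : ℂ) := by
    rw [← hv]
    refine hinv.symm.trans ?_
    congr 1; funext ξ
    rw [smul_eq_mul]
    congr 2
    simp
    ring
  exact_mod_cast this

end StableTail

namespace StableTail
open ProbabilityTheory

noncomputable def qq (δ κ s : ℝ) : ℝ :=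
  Real.exp (-(κ * Real.exp (δ * s) * Real.cos (π * δ))) *
    Real.sin (κ * Real.exp (δ * s) * Real.sin (π * δ))

lemma qq_cont (δ κ : ℝ) : Continuous (qq δ κ) := by
  unfold qq; fun_prop

lemma Psi_im (δ κ x s : ℝ) : (Psi δ κ x ((s:ℂ) + π * Complex.I)).im =
    Real.exp (-(x * Real.exp s)) * qq δ κ s * (Real.exp s / (1 + Real.exp s)) := by
  unfold Psi
  have h1 : Complex.exp ((s:ℂ) + π * Complex.I) = ((-Real.exp s : ℝ) : ℂ) := by
    rw [Complex.exp_add, Complex.exp_pi_mul_I]; push_cast; ring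
  have h2 : Complex.exp ((s:ℂ) + π * Complex.I) / (1 - Complex.exp ((s:ℂ) + π * Complex.I)) =
      ((-(Real.exp s / (1 + Real.exp s)) : ℝ) : ℂ) := by
    rw [h1]; push_cast; ring
  rw [mul_div_assoc, h2, Complex.im_mul_ofReal, Complex.exp_im, h1, exp_δsθ]
  have e1 : ((x:ℂ) * ((-Real.exp s : ℝ) : ℂ) - κ * (⟨Real.exp (δ * s) * Real.cos (δ * π),
      Real.exp (δ * s) * Real.sin (δ * π)⟩ : ℂ)).re = -(x * Real.exp s) +
      -(κ * Real.exp (δ * s) * Real.cos (π * δ)) := by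
    simp only [Complex.sub_re, Complex.re_ofReal_mul, Complex.ofReal_re, mul_comm δ π]; ring
  have e2 : ((x:ℂ) * ((-Real.exp s : ℝ) : ℂ) - κ * (⟨Real.exp (δ * s) * Real.cos (δ * π),
      Real.exp (δ * s) * Real.sin (δ * π)⟩ : ℂ)).im =
      -(κ * Real.exp (δ * s) * Real.sin (π * δ)) := by
    simp only [Complex.sub_im, Complex.im_ofReal_mul, Complex.ofReal_im, mul_comm δ π]; ring
  rw [e1, e2, Real.exp_add, Real.sin_neg]
  unfold qq
  ring

lemma G_integrable (δ κ x : ℝ) (hδ0 : 0 < δ) (hδ1 : δ < 1) (hκ : 0 < κ) (hx : 0 < x) :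
    Integrable (fun s : ℝ => Real.exp (-(x * Real.exp s)) * qq δ κ s) := by
  obtain ⟨C, hC⟩ := young δ κ (x / 2) hδ1 hδ0 hκ (by positivity)
  have hB := (integrable_exp_expneg (x / 2) δ 1 (by positivity) hδ0 one_pos).const_mul
    (κ * Real.exp C)
  have := qq_cont δ κ
  refine hB.mono' (Continuous.aestronglyMeasurable (by fun_prop)) ?_
  refine Filter.Eventually.of_forall fun s => ?_
  have hE := Real.exp_pos (δ * s)
  rw [norm_mul, Real.norm_eq_abs, Real.norm_eq_abs, abs_of_pos (Real.exp_pos _), qq, abs_mul,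
    abs_of_pos (Real.exp_pos _)]
  have h1 : |Real.sin (κ * Real.exp (δ * s) * Real.sin (π * δ))| ≤ κ * Real.exp (δ * s) := by
    refine (Real.abs_sin_le_abs).trans ?_
    rw [abs_mul, abs_of_pos (by positivity)]
    exact mul_le_of_le_one_right (by positivity) (Real.abs_sin_le_one _)
  have h2 : Real.exp (-(κ * Real.exp (δ * s) * Real.cos (π * δ))) ≤
      Real.exp (x / 2 * Real.exp s + C) := by
    apply Real.exp_le_exp.2
    refine le_trans ?_ (hC s)
    have := Real.neg_one_le_cos (π * δ)
    have h0 : 0 < κ * Real.exp (δ * s) := by positivity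
    nlinarith
  calc _ ≤ Real.exp (-(x * Real.exp s)) * (Real.exp (x / 2 * Real.exp s + C) * (κ * Real.exp (δ * s))) := by
        gcongr
    _ = κ * Real.exp C * (Real.exp (δ * s) *
        (Real.exp (-(x * Real.exp s)) * Real.exp (x / 2 * Real.exp s))) := by
        rw [Real.exp_add]; ring
    _ = _ := by
        rw [← Real.exp_add]
        congr 3
        rw [one_mul]; ring

lemma G_continuousAt (δ κ x : ℝ) (hδ0 : 0 < δ) (hδ1 : δ < 1) (hκ : 0 < κ) (hx : 0 < x) :
    ContinuousAt (fun y => ∫ s : ℝ, Real.exp (-(y * Real.exp s)) * qq δ κ s) x := by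
  have := qq_cont δ κ
  apply continuousAt_of_dominated
    (bound := fun s => ‖Real.exp (-(x / 2 * Real.exp s)) * qq δ κ s‖)
  · exact Filter.Eventually.of_forall fun y => Continuous.aestronglyMeasurable (by fun_prop)
  · filter_upwards [Ioi_mem_nhds (show x / 2 < x by linarith)] with y hy
    refine Filter.Eventually.of_forall fun s => ?_
    rw [norm_mul, norm_mul, Real.norm_eq_abs, Real.norm_eq_abs (Real.exp _),
      abs_of_pos (Real.exp_pos _), abs_of_pos (Real.exp_pos _)]
    have := Set.mem_Ioi.1 hy
    gcongr
  · exact (G_integrable δ κ (x / 2) hδ0 hδ1 hκ (by positivity)).norm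
  · exact Filter.Eventually.of_forall fun s => by fun_prop

lemma kern_tail (u x : ℝ) : kern u x + ∫ y in Set.Ioi x, kern u y =
    Set.indicator (Set.Ioi x) (fun _ => (1:ℝ)) u := by
  rw [kern_eq, setIntegral_indicator measurableSet_Iio, Set.Ioi_inter_Iio]
  rcases lt_or_ge x u with h | h
  · rw [Set.indicator_of_mem (Set.mem_Iio.2 h), Set.indicator_of_mem (Set.mem_Ioi.2 h),
      ← integral_Ioc_eq_integral_Ioo, ← intervalIntegral.integral_of_le h.le,
      intervalIntegral.integral_const_mul, integral_exp, mul_sub, ← Real.exp_add, ← Real.exp_add]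
    simp
  · rw [Set.indicator_of_notMem (by simpa using h), Set.indicator_of_notMem (by simpa using h),
      Set.Ioo_eq_empty (by simpa using h)]
    simp

lemma tail_eq (ν : Measure ℝ) [IsProbabilityMeasure ν] (x : ℝ) :
    (ν (Set.Ioi x)).toReal = ff ν x + ∫ y in Set.Ioi x, ff ν y := by
  have hI : Integrable (Function.uncurry kern) (ν.prod (volume.restrict (Set.Ioi x))) := by
    have := (kern_prod_integrable ν).integrableOn (s := Set.univ ×ˢ Set.Ioi x)
    rwa [IntegrableOn, ← Measure.prod_restrict, Measure.restrict_univ] at this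
  have h1 : ∫ y in Set.Ioi x, ff ν y = ∫ u, (∫ y in Set.Ioi x, kern u y) ∂ν := by
    unfold ff
    exact (integral_integral_swap hI).symm
  rw [h1, ff, ← integral_add]
  · simp_rw [kern_tail]
    rw [integral_indicator measurableSet_Ioi]
    simp [Measure.real]
  · refine (integrable_const (1:ℝ)).mono'
      (kern_meas.comp (measurable_id.prodMk measurable_const)).aestronglyMeasurable
      (Filter.Eventually.of_forall fun u => ?_)
    rw [Real.norm_of_nonneg (kern_nonneg u x)]
    exact kern_le u x
  · exact hI.integral_prod_left

lemma fubini_two (δ κ x : ℝ) (hδ0 : 0 < δ) (hδ1 : δ < 1) (hκ : 0 < κ) (hx : 0 < x) :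
    ∫ y in Set.Ioi x, ∫ s : ℝ, Real.exp (-(y * Real.exp s)) * qq δ κ s *
      (Real.exp s / (1 + Real.exp s)) =
    ∫ s : ℝ, Real.exp (-(x * Real.exp s)) * qq δ κ s * (1 / (1 + Real.exp s)) := by
  have hq := qq_cont δ κ
  have hI : ∀ s : ℝ, ∫ y in Set.Ioi x, Real.exp (-(y * Real.exp s)) =
      Real.exp (-(x * Real.exp s)) / Real.exp s := by
    intro s
    have := integral_exp_mul_Ioi (a := -Real.exp s) (by simp [Real.exp_pos]) x
    rw [neg_div_neg_eq] at this
    convert this using 3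
    · congr 1; ring
    · ring_nf
  have hIn : ∀ s : ℝ, IntegrableOn (fun y => Real.exp (-(y * Real.exp s))) (Set.Ioi x) := by
    intro s
    have := integrableOn_exp_mul_Ioi (a := -Real.exp s) (by simp [Real.exp_pos]) x
    refine this.congr_fun (fun y _ => ?_) measurableSet_Ioi
    simp only []
    congr 1; ring
  have hpos : ∀ s : ℝ, 0 < 1 + Real.exp s := fun s => by positivity
  have hcont : Continuous (Function.uncurry fun y s : ℝ => Real.exp (-(y * Real.exp s)) * qq δ κ s *
      (Real.exp s / (1 + Real.exp s))) := by
    unfold Function.uncurry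
    fun_prop (disch := exact fun p => (hpos _).ne')
  rw [integral_integral_swap]
  · congr 1; funext s
    rw [integral_mul_const, integral_mul_const, hI]
    have := Real.exp_pos s
    field_simp
  · rw [integrable_prod_iff' hcont.aestronglyMeasurable]
    refine ⟨Filter.Eventually.of_forall fun s =>
      ((hIn s).mul_const (qq δ κ s)).mul_const (Real.exp s / (1 + Real.exp s)), ?_⟩
    have hG := (G_integrable δ κ x hδ0 hδ1 hκ hx).norm
    refine hG.mono' ?_ ?_
    · exact (hcont.aestronglyMeasurable (μ := (volume.restrict (Set.Ioi x)).prod volume)).norm.prod_swap.integral_prod_right'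
    · refine Filter.Eventually.of_forall fun s => ?_
      have e : ∀ y : ℝ, ‖Function.uncurry (fun y s : ℝ => Real.exp (-(y * Real.exp s)) * qq δ κ s *
          (Real.exp s / (1 + Real.exp s))) (y, s)‖ = Real.exp (-(y * Real.exp s)) * |qq δ κ s| *
          (Real.exp s / (1 + Real.exp s)) := by
        intro y
        simp only [Function.uncurry, norm_mul, Real.norm_eq_abs, Real.abs_exp]
        rw [abs_of_pos (show 0 < Real.exp s / (1 + Real.exp s) by positivity)]
      simp_rw [e]
      rw [integral_mul_const, integral_mul_const, hI]
      rw [Real.norm_eq_abs, Real.norm_eq_abs, abs_mul _ (qq δ κ s), Real.abs_exp]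
      have h1 := Real.exp_pos s
      have : Real.exp (-(x * Real.exp s)) / Real.exp s * |qq δ κ s| * (Real.exp s / (1 + Real.exp s))
          = Real.exp (-(x * Real.exp s)) * |qq δ κ s| / (1 + Real.exp s) := by
        field_simp
      rw [this, abs_of_nonneg (by positivity)]
      exact div_le_self (by positivity) (by linarith)

lemma tail_formula_of_not_atom (δ κ : ℝ) (hδ0 : 0 < δ) (hδ1 : δ < 1) (hκ : 0 < κ)
    (ν : Measure ℝ) [IsProbabilityMeasure ν] (hsupp : ν (Set.Iio 0) = 0)
    (hlap : ∀ s : ℝ, 0 < s →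
      ∫ u, Real.exp (-(s * u)) ∂ν = Real.exp (-(κ * s ^ δ)))
    (hcount : {y : ℝ | ν {y} ≠ 0}.Countable)
    (x : ℝ) (hx : 0 < x) (hν : ν {x} = 0) :
    (ν (Set.Ioi x)).toReal = 1 / π * ∫ s : ℝ, Real.exp (-(x * Real.exp s)) * qq δ κ s := by
  have hp := Real.pi_pos
  have hq := qq_cont δ κ
  have hpos : ∀ s : ℝ, 0 < 1 + Real.exp s := fun s => by positivity
  have hf : ∀ y : ℝ, 0 < y → ν {y} = 0 → ff ν y = 1 / π * ∫ s : ℝ, Real.exp (-(y * Real.exp s)) *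
      qq δ κ s * (Real.exp s / (1 + Real.exp s)) := by
    intro y hy hνy
    rw [ff_formula δ κ hδ0 hδ1 hκ ν hsupp hlap y hy hνy]
    have hi := Psi_integrable δ κ y hδ0 hδ1 hκ hy π (by linarith) le_rfl
    have := integral_im hi
    simp only [RCLike.im_to_complex] at this
    rw [← this]
    simp_rw [Psi_im]
  have h2 : ∫ y in Set.Ioi x, ff ν y = 1 / π * ∫ s : ℝ, Real.exp (-(x * Real.exp s)) *
      qq δ κ s * (1 / (1 + Real.exp s)) := by
    rw [← fubini_two δ κ x hδ0 hδ1 hκ hx, ← integral_const_mul]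
    apply setIntegral_congr_ae measurableSet_Ioi
    have : ∀ᵐ y : ℝ, ν {y} = 0 := by
      rw [ae_iff]; exact hcount.measure_zero _
    filter_upwards [this] with y hy hxy
    exact hf y (hx.trans hxy) hy
  have hG := G_integrable δ κ x hδ0 hδ1 hκ hx
  have hb : ∀ g : ℝ → ℝ, Continuous g → (∀ s, ‖g s‖ ≤ 1) →
      Integrable (fun s : ℝ => Real.exp (-(x * Real.exp s)) * qq δ κ s * g s) := by
    intro g hg hg1
    exact hG.mul_bdd (c := 1) hg.aestronglyMeasurable (Filter.Eventually.of_forall hg1)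
  rw [tail_eq, hf x hx hν, h2, ← mul_add, ← integral_add]
  · congr 2; funext s
    have := (hpos s).ne'
    field_simp
    ring
  · apply hb
    · fun_prop (disch := exact fun p => (hpos _).ne')
    · intro s
      have := Real.exp_pos s
      rw [Real.norm_of_nonneg (by positivity), div_le_one (hpos s)]
      linarith
  · apply hb
    · fun_prop (disch := exact fun p => (hpos _).ne')
    · intro s
      have := Real.exp_pos s
      rw [Real.norm_of_nonneg (by positivity), div_le_one (hpos s)]
      linarith

lemma atoms_countable (ν : Measure ℝ) [IsProbabilityMeasure ν] :
    {y : ℝ | ν {y} ≠ 0}.Countable := by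
  have := Measure.countable_meas_pos_of_disjoint_iUnion (μ := ν) (As := fun y : ℝ => {y})
    (fun y => measurableSet_singleton y) (fun a b h => by simpa [Function.onFun] using h)
  simpa [pos_iff_ne_zero] using this

lemma tail_formula (δ κ : ℝ) (hδ0 : 0 < δ) (hδ1 : δ < 1) (hκ : 0 < κ)
    (ν : Measure ℝ) [IsProbabilityMeasure ν] (hsupp : ν (Set.Iio 0) = 0)
    (hlap : ∀ s : ℝ, 0 < s →
      ∫ u, Real.exp (-(s * u)) ∂ν = Real.exp (-(κ * s ^ δ)))
    (x : ℝ) (hx : 0 < x) :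
    (ν (Set.Ioi x)).toReal = 1 / π * ∫ s : ℝ, Real.exp (-(x * Real.exp s)) * qq δ κ s := by
  have hcount := atoms_countable ν
  have hT : ∀ y, (ν (Set.Ioi y)).toReal = 1 - cdf ν y := by
    intro y
    rw [cdf_eq_real, ← Set.compl_Iic]
    exact probReal_compl_eq_one_sub measurableSet_Iic
  have l1 : Filter.Tendsto (fun y => (ν (Set.Ioi y)).toReal) (nhdsWithin x (Set.Ioi x))
      (nhds ((ν (Set.Ioi x)).toReal)) := by
    simp_rw [hT]
    exact (((cdf ν).right_continuous x).mono Set.Ioi_subset_Ici_self).tendsto.const_sub 1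
  have l2 : Filter.Tendsto (fun y => 1 / π * ∫ s : ℝ, Real.exp (-(y * Real.exp s)) * qq δ κ s)
      (nhdsWithin x (Set.Ioi x))
      (nhds (1 / π * ∫ s : ℝ, Real.exp (-(x * Real.exp s)) * qq δ κ s)) :=
    ((G_continuousAt δ κ x hδ0 hδ1 hκ hx).tendsto.mono_left nhdsWithin_le_nhds).const_mul _
  refine tendsto_nhds_unique_of_frequently_eq l1 l2 ?_
  have hfr : ∃ᶠ y in nhdsWithin x (Set.Ioi x), ν {y} = 0 := by
    intro h
    obtain ⟨b, hb, hb2⟩ := mem_nhdsGT_iff_exists_Ioo_subset.1 h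
    have h0 : volume (Set.Ioo x b) = 0 := measure_mono_null hb2 (hcount.measure_zero _)
    rw [Real.volume_Ioo, ENNReal.ofReal_eq_zero] at h0
    have := Set.mem_Ioi.1 hb
    linarith
  refine (hfr.and_eventually self_mem_nhdsWithin).mono fun y hy => ?_
  exact tail_formula_of_not_atom δ κ hδ0 hδ1 hκ ν hsupp hlap hcount y (hx.trans hy.2) hy.1

end StableTail

/-- Lemma 5 / equation (16): tail of a positive stable law via inverse Laplace transform.
If `ν` is a probability measure on `[0,∞)` with Laplace transform `exp(−κ s^δ)`,
`δ ∈ (0,1)`, `κ > 0`, then for every `x > 0`,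
`ν((x,∞)) = (1/(πδ)) ∫_0^∞ (1/w) exp(−x (w/κ)^{1/δ}) exp(−w cos(πδ)) sin(w sin(πδ)) dw`. -/
theorem stable_tail_inverse_laplace (δ κ : ℝ) (hδ0 : 0 < δ) (hδ1 : δ < 1) (hκ : 0 < κ)
    (ν : Measure ℝ) [IsProbabilityMeasure ν] (hsupp : ν (Set.Iio 0) = 0)
    (hlap : ∀ s : ℝ, 0 < s →
      ∫ u, Real.exp (-(s * u)) ∂ν = Real.exp (-(κ * s ^ δ)))
    (x : ℝ) (hx : 0 < x) :
    (ν (Set.Ioi x)).toReal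
      = (1 / (π * δ)) * ∫ w in Set.Ioi (0 : ℝ),
          (1 / w) * Real.exp (-(x * (w / κ) ^ (1 / δ)))
            * Real.exp (-(w * Real.cos (π * δ))) * Real.sin (w * Real.sin (π * δ)) := by
  have hp := Real.pi_pos
  rw [StableTail.tail_formula δ κ hδ0 hδ1 hκ ν hsupp hlap x hx,
    StableTail.integral_scaled_exp κ δ hκ hδ0, ← integral_const_mul, ← integral_const_mul]
  congr 1; funext s
  have h1 : (κ * Real.exp (δ * s) / κ) ^ (1 / δ) = Real.exp s := by
    rw [mul_div_cancel_left₀ _ hκ.ne', ← Real.exp_mul]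
    congr 1; field_simp
  rw [h1, StableTail.qq, smul_eq_mul]
  have := Real.exp_pos (δ * s)
  field_simp
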